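/- Let q ∈ (0,1) be fixed and let m : ℕ → ℕ be a function with m(n) ≥ 1 and m(n) = o(√n) (i.e., m(n)/√n → 0 as n → ∞). Then ∑_{k=0}^{n} φ_q(k,n)^{m(n)} ∼ (2πq(1−q)n)^{−(m(n)−1)/2} / √(m(n)) as n → ∞; i.e., (∑_{k=0}^{n} φ_q(k,n)^{m(n)}) · (2πq(1−q)n)^{(m(n)−1)/2} · √(m(n)) tends to 1 as n → ∞. -/

import Mathlib

open Finset

/-- The binomial probability mass function. -/
noncomputable def phi (q : ℝ) (k n : ℕ) : ℝ :=
  (n.choose k : ℝ) * q ^ k * (1 - q) ^ (n - k)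

noncomputable def th (n : ℕ) : ℝ :=
  Real.log (n.factorial) - (n * Real.log n - n + Real.log n / 2 + Real.log (2 * Real.pi) / 2)

lemma th_eq {n : ℕ} (hn : n ≠ 0) :
    th n = Real.log (Stirling.stirlingSeq n) - Real.log (Real.sqrt Real.pi) := by
  have hn' : (n : ℝ) ≠ 0 := by exact_mod_cast hn
  rw [Stirling.log_stirlingSeq_formula, th, Real.log_sqrt Real.pi_pos.le,
    Real.log_div hn' (Real.exp_pos 1).ne', Real.log_exp, Real.log_mul two_ne_zero hn',
    Real.log_mul two_ne_zero Real.pi_pos.ne']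
  ring

lemma th_nonneg {n : ℕ} (hn : n ≠ 0) : 0 ≤ th n := by
  have := Stirling.le_log_factorial_stirling hn
  unfold th
  linarith

lemma th_le {n : ℕ} (hn : n ≠ 0) : th n ≤ 1 / (12 * n) := by
  rw [th_eq hn]
  let u : ℕ → ℝ := fun j => Real.log (Stirling.stirlingSeq (j + 1)) - 1 / (12 * ((j : ℝ) + 1))
  have hu : Monotone u := by
    refine monotone_nat_of_le_succ fun j => ?_
    have h := Stirling.log_stirlingSeq_sdiff_le (j + 1)
    have e : (1 : ℝ) / (12 * ((j : ℝ) + 1)) - 1 / (12 * ((j : ℝ) + 1 + 1))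
        = 1 / (12 * ((j : ℝ) + 1) * ((j : ℝ) + 1 + 1)) := by
      have : (j : ℝ) + 1 ≠ 0 := by positivity
      have : (j : ℝ) + 1 + 1 ≠ 0 := by positivity
      field_simp
      ring
    simp only [u]
    push_cast at h ⊢
    linarith
  have hl : Filter.Tendsto u Filter.atTop (nhds (Real.log (Real.sqrt Real.pi) - 0)) := by
    refine Filter.Tendsto.sub ?_ ?_
    · exact ((Real.continuousAt_log (by positivity)).tendsto.comp
        (Stirling.tendsto_stirlingSeq_sqrt_pi.comp (Filter.tendsto_add_atTop_nat 1)))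
    · have := (tendsto_one_div_add_atTop_nhds_zero_nat (𝕜 := ℝ)).const_mul (1 / 12)
      rw [mul_zero] at this
      refine this.congr fun j => ?_
      have : (j : ℝ) + 1 ≠ 0 := by positivity
      field_simp
  obtain ⟨j, rfl⟩ := Nat.exists_eq_succ_of_ne_zero hn
  have := hu.ge_of_tendsto hl j
  simp only [u] at this
  push_cast
  simp only [Nat.succ_eq_add_one] at *
  linarith

/-- relative entropy -/
noncomputable def kl (q p : ℝ) : ℝ :=
  p * Real.log p + (1 - p) * Real.log (1 - p) - p * Real.log q - (1 - p) * Real.log (1 - q)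

lemma hell {p q : ℝ} (hp : 0 ≤ p) (hq : 0 < q) :
    2 * p - 2 * (Real.sqrt p * Real.sqrt q) ≤ p * Real.log p - p * Real.log q := by
  rcases hp.eq_or_lt with rfl | hp
  · simp
  have h := Real.log_le_sub_one_of_pos (x := Real.sqrt q / Real.sqrt p) (by positivity)
  rw [Real.log_div (by positivity) (by positivity), Real.log_sqrt hp.le, Real.log_sqrt hq.le] at h
  have h2 := mul_le_mul_of_nonneg_left h hp.le
  have e : p * (Real.sqrt q / Real.sqrt p - 1) = Real.sqrt p * Real.sqrt q - p := by
    have := Real.sqrt_pos.2 hp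
    have e := Real.mul_self_sqrt hp.le
    field_simp
    linear_combination -Real.sqrt q * e
  rw [e] at h2
  linarith

lemma kl_ge {p q : ℝ} (hp : 0 ≤ p) (hp1 : p ≤ 1) (hq : 0 < q) (hq1 : q < 1) :
    (p - q) ^ 2 / 4 ≤ kl q p := by
  have h1 := hell hp hq
  have h2 := hell (p := 1 - p) (q := 1 - q) (by linarith) (by linarith)
  unfold kl
  have e1 := Real.sq_sqrt hp
  have e2 := Real.sq_sqrt hq.le
  have e3 := Real.sq_sqrt (show 0 ≤ 1 - p by linarith)
  have e4 := Real.sq_sqrt (show 0 ≤ 1 - q by linarith)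
  have b1 : Real.sqrt p ≤ 1 := Real.sqrt_le_one.2 hp1
  have b2 : Real.sqrt q ≤ 1 := Real.sqrt_le_one.2 hq1.le
  have c1 := Real.sqrt_nonneg p
  have c2 := Real.sqrt_nonneg q
  set a := Real.sqrt p
  set b := Real.sqrt q
  set c := Real.sqrt (1 - p)
  set d := Real.sqrt (1 - q)
  have key : (p - q) ^ 2 / 4 ≤ (a - b) ^ 2 := by
    rw [← e1, ← e2]
    have : (a ^ 2 - b ^ 2) ^ 2 = (a - b) ^ 2 * (a + b) ^ 2 := by ring
    rw [this]
    have : (a + b) ^ 2 ≤ 4 := by nlinarith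
    nlinarith [mul_le_mul_of_nonneg_left this (sq_nonneg (a - b))]
  nlinarith [sq_nonneg (c - d)]

lemma xlog_taylor {u : ℝ} (hu : |u| ≤ 1 / 2) :
    |(1 + u) * Real.log (1 + u) - u - u ^ 2 / 2| ≤ 4 * |u| ^ 3 := by
  have h := Real.abs_log_sub_add_sum_range_le (x := -u) (by rw [abs_neg]; linarith) 2
  simp only [Finset.sum_range_succ, Finset.sum_range_zero, abs_neg, sub_neg_eq_add] at h
  norm_num at h
  set E := -u + u ^ 2 / 2 + Real.log (1 + u) with hE
  have hE2 : |E| ≤ 2 * |u| ^ 3 := by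
    refine h.trans ?_
    rw [div_le_iff₀ (by linarith)]
    have : 0 ≤ |u| ^ 3 := by positivity
    nlinarith
  have e : (1 + u) * Real.log (1 + u) - u - u ^ 2 / 2 = -(u ^ 3 / 2) + (1 + u) * E := by
    rw [hE]; ring
  rw [e]
  refine (abs_add_le _ _).trans ?_
  rw [abs_neg, abs_div, abs_pow, abs_mul, abs_two]
  have : |1 + u| ≤ 3 / 2 := by
    refine (abs_add_le _ _).trans ?_
    rw [abs_one]; linarith
  have := mul_le_mul this hE2 (abs_nonneg _) (by norm_num)
  have : 0 ≤ |u| ^ 3 := by positivity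
  linarith

lemma half_taylor {p q : ℝ} (hq : 0 < q) (hpq : |p - q| ≤ q / 2) :
    |p * Real.log p - p * Real.log q - (p - q) - (p - q) ^ 2 / (2 * q)|
      ≤ 4 / q ^ 2 * |p - q| ^ 3 := by
  have hp : 0 < p := by have := abs_le.1 hpq; linarith
  have hu : |(p - q) / q| ≤ 1 / 2 := by
    rw [abs_div, abs_of_pos hq, div_le_iff₀ hq]; linarith
  have h := xlog_taylor hu
  have e : 1 + (p - q) / q = p / q := by field_simp; ring
  rw [e, Real.log_div hp.ne' hq.ne'] at h
  have e2 : p * Real.log p - p * Real.log q - (p - q) - (p - q) ^ 2 / (2 * q)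
    = q * (p / q * (Real.log p - Real.log q) - (p - q) / q - ((p - q) / q) ^ 2 / 2) := by
    field_simp
  rw [e2, abs_mul, abs_of_pos hq]
  refine (mul_le_mul_of_nonneg_left h hq.le).trans (le_of_eq ?_)
  rw [abs_div, abs_of_pos hq]
  field_simp

lemma kl_taylor {q : ℝ} (hq : 0 < q) (hq1 : q < 1) :
    ∃ C : ℝ, ∀ p, |p - q| ≤ q / 2 → |p - q| ≤ (1 - q) / 2 →
      |kl q p - (p - q) ^ 2 / (2 * (q * (1 - q)))| ≤ C * |p - q| ^ 3 := by
  refine ⟨4 / q ^ 2 + 4 / (1 - q) ^ 2, fun p h1 h2 => ?_⟩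
  have hq' : 0 < 1 - q := by linarith
  have a1 := half_taylor hq h1
  have e0 : (1 - p) - (1 - q) = -(p - q) := by ring
  have a2 := half_taylor (p := 1 - p) (q := 1 - q) hq' (by rw [e0, abs_neg]; exact h2)
  rw [e0, abs_neg] at a2
  have e : kl q p - (p - q) ^ 2 / (2 * (q * (1 - q)))
    = (p * Real.log p - p * Real.log q - (p - q) - (p - q) ^ 2 / (2 * q))
     + ((1 - p) * Real.log (1 - p) - (1 - p) * Real.log (1 - q) - -(p - q)
        - (-(p - q)) ^ 2 / (2 * (1 - q))) := by
    unfold kl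
    field_simp
    ring
  rw [e]
  refine (abs_add_le _ _).trans ?_
  linarith

lemma pow_eq_exp {p : ℝ} (hp : 0 ≤ p) {n k : ℕ} (hn : n ≠ 0) (h : p = k / n) :
    p ^ k = Real.exp (n * (p * Real.log p)) := by
  have hn' : (n : ℝ) ≠ 0 := by exact_mod_cast hn
  have hk : (k : ℝ) = n * p := by rw [h]; field_simp
  rcases hp.eq_or_lt with h0 | hp
  · rw [← h0, mul_zero] at hk
    have : k = 0 := by exact_mod_cast hk
    simp [this, ← h0]
  · rw [← mul_assoc, ← hk, mul_comm, Real.exp_mul, Real.exp_log hp, Real.rpow_natCast]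

lemma phi_kl {q : ℝ} (hq : 0 < q) (hq1 : q < 1) {n k : ℕ} (hn : n ≠ 0) (hk : k ≤ n) :
    phi q k n = phi (k / n) k n * Real.exp (-(n * kl q (k / n))) := by
  have hn' : (0 : ℝ) < n := by positivity
  have hkn : (k : ℝ) ≤ n := by exact_mod_cast hk
  obtain ⟨p, hp⟩ : ∃ p : ℝ, p = k / n := ⟨_, rfl⟩
  have hp0 : 0 ≤ p := by rw [hp]; positivity
  have hp1 : p ≤ 1 := by rw [hp]; exact div_le_one_of_le₀ hkn hn'.le
  have hp' : 1 - p = (n - k : ℕ) / (n : ℝ) := by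
    rw [hp, Nat.cast_sub hk]; field_simp
  rw [← hp]
  unfold phi
  rw [pow_eq_exp hp0 hn hp, pow_eq_exp (p := 1 - p) (by linarith) hn hp']
  have e1 : q ^ k = Real.exp (n * (p * Real.log q)) := by
    have hk : (k : ℝ) = n * p := by rw [hp]; field_simp
    rw [← mul_assoc, ← hk, mul_comm, Real.exp_mul, Real.exp_log hq, Real.rpow_natCast]
  have e2 : (1 - q) ^ (n - k) = Real.exp (n * ((1 - p) * Real.log (1 - q))) := by
    have hk : ((n - k : ℕ) : ℝ) = n * (1 - p) := by rw [hp']; field_simp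
    rw [← mul_assoc, ← hk, mul_comm, Real.exp_mul, Real.exp_log (by linarith), Real.rpow_natCast]
  rw [e1, e2, mul_assoc, mul_assoc, mul_assoc, ← Real.exp_add, ← Real.exp_add, ← Real.exp_add]
  congr 2
  unfold kl
  ring

lemma phi_nonneg {p : ℝ} (hp : 0 ≤ p) (hp1 : p ≤ 1) (k n : ℕ) : 0 ≤ phi p k n := by
  unfold phi
  have : 0 ≤ 1 - p := by linarith
  positivity

lemma phi_le_one {p : ℝ} (hp : 0 ≤ p) (hp1 : p ≤ 1) {n k : ℕ} (hk : k ≤ n) : phi p k n ≤ 1 := by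
  have h := add_pow p (1 - p) n
  rw [add_sub_cancel, one_pow] at h
  rw [h]
  have : phi p k n = p ^ k * (1 - p) ^ (n - k) * (n.choose k) := by unfold phi; ring
  rw [this]
  have h1 : 0 ≤ 1 - p := by linarith
  exact Finset.single_le_sum (f := fun m => p ^ m * (1 - p) ^ (n - m) * (n.choose m : ℝ))
    (fun i _ => by positivity) (by simp; omega)

lemma phi_chernoff {q : ℝ} (hq : 0 < q) (hq1 : q < 1) {n k : ℕ} (hn : n ≠ 0) (hk : k ≤ n) :
    phi q k n ≤ Real.exp (-(n * ((k / n - q) ^ 2 / 4))) := by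
  have hn' : (0 : ℝ) < n := by positivity
  have hkn : (k : ℝ) ≤ n := by exact_mod_cast hk
  have hp0 : (0 : ℝ) ≤ k / n := by positivity
  have hp1 : (k : ℝ) / n ≤ 1 := div_le_one_of_le₀ hkn hn'.le
  rw [phi_kl hq hq1 hn hk]
  refine (mul_le_of_le_one_left (Real.exp_pos _).le (phi_le_one hp0 hp1 hk)).trans ?_
  have := kl_ge hp0 hp1 hq hq1
  gcongr

/-- normalised mass -/
noncomputable def ff (q : ℝ) (n k : ℕ) : ℝ :=
  phi q k n * Real.sqrt (2 * Real.pi * q * (1 - q) * n)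

lemma ff_formula {q : ℝ} (hq : 0 < q) (hq1 : q < 1) {n k : ℕ} (hk0 : 0 < k) (hk : k < n) :
    ff q n k = Real.exp ((Real.log q - Real.log (k / n)) / 2
      + (Real.log (1 - q) - Real.log (1 - k / n)) / 2
      - n * kl q (k / n) + th n - th k - th (n - k)) := by
  obtain ⟨l, rfl⟩ : ∃ l, n = k + l := ⟨n - k, by omega⟩
  have hl0 : 0 < l := by omega
  have hq' : 0 < 1 - q := by linarith
  have hkr : (0 : ℝ) < k := by exact_mod_cast hk0
  have hlr : (0 : ℝ) < l := by exact_mod_cast hl0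
  have hpos : 0 < ff q (k + l) k := by
    unfold ff phi
    have : 0 < (k + l).choose k := Nat.choose_pos (by omega)
    positivity
  rw [← Real.exp_log hpos]
  congr 1
  have hch : ((k + l).choose k : ℝ) = (k + l).factorial / (k.factorial * l.factorial) := by
    rw [Nat.cast_choose ℝ (by omega : k ≤ k + l), Nat.add_sub_cancel_left]
  unfold ff phi
  rw [hch, Nat.add_sub_cancel_left]
  have e1 : 1 - (k : ℝ) / ((k + l : ℕ) : ℝ) = l / ((k + l : ℕ) : ℝ) := by
    push_cast; field_simp; ring
  unfold kl
  rw [e1]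
  have hN : (0 : ℝ) < ((k + l : ℕ) : ℝ) := by positivity
  have f1 : (0 : ℝ) < k.factorial := by positivity
  have f2 : (0 : ℝ) < l.factorial := by positivity
  have f3 : (0 : ℝ) < (k + l).factorial := by positivity
  rw [Real.log_mul (by positivity) (by positivity), Real.log_mul (by positivity) (by positivity),
    Real.log_mul (by positivity) (by positivity), Real.log_div (by positivity) (by positivity),
    Real.log_mul (by positivity) (by positivity), Real.log_pow, Real.log_pow,
    Real.log_sqrt (by positivity), Real.log_mul (by positivity) (by positivity),
    Real.log_mul (by positivity) (by positivity), Real.log_mul (by positivity) (by positivity),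
    Real.log_div (by positivity) (by positivity), Real.log_div (by positivity) (by positivity)]
  unfold th
  have hc : ((k + l : ℕ) : ℝ) = k + l := by push_cast; ring
  generalize Real.log ((k + l : ℕ) : ℝ) = LN
  rw [hc]
  field_simp
  ring

lemma log_diff_le {p q : ℝ} (hq : 0 < q) (hp : q / 2 ≤ p) :
    Real.log q - Real.log p ≤ 2 / q * |p - q| := by
  have hp0 : 0 < p := by linarith
  rw [← Real.log_div hq.ne' hp0.ne']
  refine (Real.log_le_sub_one_of_pos (by positivity)).trans ?_
  have e : q / p - 1 = (q - p) / p := by field_simp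
  rw [e]
  calc (q - p) / p ≤ |p - q| / p := by
        gcongr
        rw [abs_sub_comm]; exact le_abs_self _
    _ ≤ |p - q| / (q / 2) := by gcongr
    _ = _ := by field_simp

lemma abs_log_diff_le {p q : ℝ} (hq : 0 < q) (hp : q / 2 ≤ p) :
    |Real.log q - Real.log p| ≤ 2 / q * |p - q| := by
  rw [abs_le]
  refine ⟨?_, log_diff_le hq hp⟩
  have hp0 : 0 < p := by linarith
  have : Real.log p - Real.log q ≤ 2 / q * |p - q| := by
    rw [← Real.log_div hp0.ne' hq.ne']
    refine (Real.log_le_sub_one_of_pos (by positivity)).trans ?_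
    have e : p / q - 1 = (p - q) / q := by field_simp
    rw [e]
    have : (p - q) / q ≤ |p - q| / q := by
      gcongr
      exact le_abs_self _
    have h2 : 2 / q * |p - q| = 2 * (|p - q| / q) := by ring
    have : 0 ≤ |p - q| / q := by positivity
    linarith
  linarith

lemma ff_bound {q : ℝ} (hq : 0 < q) (hq1 : q < 1) :
    ∃ C : ℝ, 0 ≤ C ∧ ∀ᶠ n : ℕ in Filter.atTop, ∀ k : ℕ,
      ff q n k ≤ Real.exp (-(n * ((k : ℝ) / n - q) ^ 2 / 8) + C / n) := by
  have hq' : 0 < 1 - q := by linarith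
  set C1 : ℝ := 1 / q + 1 / (1 - q) with hC1
  set d0 : ℝ := min (q / 2) ((1 - q) / 2) with hd0
  have hd0p : 0 < d0 := lt_min (by linarith) (by linarith)
  set A : ℝ := 2 * Real.pi * q * (1 - q) with hA
  have hAp : 0 < A := by positivity
  set c : ℝ := d0 ^ 2 / 8 with hc
  have hcp : 0 < c := by positivity
  refine ⟨2 * C1 ^ 2 + 1, by positivity, ?_⟩
  filter_upwards [Filter.eventually_ge_atTop 1,
    Filter.tendsto_atTop.1 (tendsto_natCast_atTop_atTop (R := ℝ)) (A / c ^ 2)] with n hn hnA k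
  have hn0 : n ≠ 0 := by omega
  have hnr : (0 : ℝ) < n := by exact_mod_cast hn
  by_cases hkn : k ≤ n
  swap
  · have : ff q n k = 0 := by
      unfold ff phi
      rw [Nat.choose_eq_zero_of_lt (by omega)]; simp
    rw [this]; positivity
  have hkn' : (k : ℝ) ≤ n := by exact_mod_cast hkn
  have hp0 : (0 : ℝ) ≤ k / n := by positivity
  have hp1 : (k : ℝ) / n ≤ 1 := div_le_one_of_le₀ hkn' hnr.le
  by_cases hd : |(k : ℝ) / n - q| ≤ d0
  · have h1 : |(k : ℝ) / n - q| ≤ q / 2 := hd.trans (min_le_left _ _)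
    have h2 : |(k : ℝ) / n - q| ≤ (1 - q) / 2 := hd.trans (min_le_right _ _)
    have hpl : q / 2 ≤ (k : ℝ) / n := by have := (abs_le.1 h1).1; linarith
    have hpu : (1 - q) / 2 ≤ 1 - (k : ℝ) / n := by have := (abs_le.1 h2).2; linarith
    have hk0 : 0 < k := by
      rcases Nat.eq_zero_or_pos k with h | h
      · rw [h] at hpl; simp at hpl; linarith
      · exact h
    have hkn2 : k < n := by
      rcases hkn.eq_or_lt with h | h
      · rw [h, div_self hnr.ne'] at hpu; linarith
      · exact h
    rw [ff_formula hq hq1 hk0 hkn2]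
    have l1 := log_diff_le hq hpl
    have l2 := log_diff_le hq' hpu
    have e0 : 1 - (k : ℝ) / n - (1 - q) = -((k : ℝ) / n - q) := by ring
    rw [e0, abs_neg] at l2
    have k1 := kl_ge hp0 hp1 hq hq1
    have t1 := th_le hn0
    have t2 := th_nonneg (n := k) (by omega)
    have t3 := th_nonneg (n := n - k) (by omega)
    rw [← sq_abs] at k1
    rw [← sq_abs ((k : ℝ) / n - q)]
    set d := |(k : ℝ) / n - q|
    have k2 := mul_le_mul_of_nonneg_left k1 hnr.le
    have am : C1 * d ≤ n * d ^ 2 / 8 + 2 * C1 ^ 2 / n := by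
      have : n * d ^ 2 / 8 + 2 * C1 ^ 2 / n - C1 * d = (n * d - 4 * C1) ^ 2 / (8 * n) := by
        field_simp; ring
      have h0 : 0 ≤ (n * d - 4 * C1) ^ 2 / (8 * n) := by positivity
      linarith
    have hs : 2 / q * d / 2 + 2 / (1 - q) * d / 2 = C1 * d := by rw [hC1]; field_simp
    have t4 : (1 : ℝ) / (12 * n) ≤ 1 / n := by
      apply one_div_le_one_div_of_le hnr; linarith
    rw [add_div]
    apply Real.exp_le_exp.2
    linarith
  · have hd := (not_le.1 hd).le
    have hch := phi_chernoff hq hq1 hn0 hkn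
    have hs : Real.sqrt (A * n) ≤ Real.exp (c * n) := by
      rw [Real.sqrt_le_left (Real.exp_pos _).le]
      have h1 : c * n ≤ Real.exp (c * n) := by
        have := Real.add_one_le_exp (c * (n : ℝ)); linarith
      have h2 : (c * n) ^ 2 ≤ Real.exp (c * n) ^ 2 := by gcongr
      rw [div_le_iff₀ (by positivity)] at hnA
      have := mul_le_mul_of_nonneg_right hnA hnr.le
      nlinarith
    have hsq : d0 ^ 2 ≤ ((k : ℝ) / n - q) ^ 2 := by
      rw [← sq_abs ((k : ℝ) / n - q)]; gcongr
    unfold ff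
    refine (mul_le_mul hch hs (Real.sqrt_nonneg _) (Real.exp_pos _).le).trans ?_
    rw [← Real.exp_add]
    apply Real.exp_le_exp.2
    have h3 : c * n ≤ n * ((k : ℝ) / n - q) ^ 2 / 8 := by
      rw [hc]
      have := mul_le_mul_of_nonneg_left hsq hnr.le
      linarith
    have : 0 ≤ (2 * C1 ^ 2 + 1) / n := by positivity
    linarith

open Filter Topology in
lemma ff_pointwise {q : ℝ} (hq : 0 < q) (hq1 : q < 1) (m k : ℕ → ℕ) (hm1 : ∀ n, 1 ≤ m n)
    (hm : Tendsto (fun n : ℕ => (m n : ℝ) / n) atTop (𝓝 0)) (Y : ℝ)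
    (hY : Tendsto (fun n : ℕ => (m n : ℝ) * n * ((k n : ℝ) / n - q) ^ 2) atTop (𝓝 Y)) :
    Tendsto (fun n : ℕ => ff q n (k n) ^ m n) atTop (𝓝 (Real.exp (-(Y / (2 * (q * (1 - q))))))) := by
  have hq' : 0 < 1 - q := by linarith
  -- p → q
  have hsq : Tendsto (fun n : ℕ => ((k n : ℝ) / n - q) ^ 2) atTop (𝓝 0) := by
    have h0 := hY.mul (tendsto_one_div_atTop_nhds_zero_nat (𝕜 := ℝ))
    rw [mul_zero] at h0
    refine tendsto_of_tendsto_of_tendsto_of_le_of_le' tendsto_const_nhds h0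
      (Eventually.of_forall fun n => sq_nonneg _) ?_
    filter_upwards [eventually_ge_atTop 1] with n hn
    have hnr : (0 : ℝ) < n := by exact_mod_cast hn
    have : (1 : ℝ) ≤ m n := by exact_mod_cast hm1 n
    have e : (m n : ℝ) * n * ((k n : ℝ) / n - q) ^ 2 * (1 / n) = m n * ((k n : ℝ) / n - q) ^ 2 := by
      field_simp
    rw [e]
    exact le_mul_of_one_le_left (sq_nonneg _) this
  have habs : Tendsto (fun n : ℕ => |(k n : ℝ) / n - q|) atTop (𝓝 0) := by
    have := hsq.sqrt
    simpa [Real.sqrt_sq_eq_abs] using this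
  have hp : Tendsto (fun n : ℕ => (k n : ℝ) / n) atTop (𝓝 q) := by
    have := ((tendsto_zero_iff_abs_tendsto_zero _).2 habs).add_const q
    simpa using this
  have hp' : Tendsto (fun n : ℕ => 1 - (k n : ℝ) / n) atTop (𝓝 (1 - q)) := hp.const_sub 1
  have hmabs : Tendsto (fun n : ℕ => (m n : ℝ) * |(k n : ℝ) / n - q|) atTop (𝓝 0) := by
    have := (hY.mul hm).sqrt
    rw [mul_zero, Real.sqrt_zero] at this
    refine this.congr' ?_
    filter_upwards [eventually_ge_atTop 1] with n hn
    have hnr : (0 : ℝ) < n := by exact_mod_cast hn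
    have e : (m n : ℝ) * n * ((k n : ℝ) / n - q) ^ 2 * (m n / n)
      = ((m n : ℝ) * |(k n : ℝ) / n - q|) ^ 2 := by
      rw [mul_pow, sq_abs]; field_simp
    rw [e, Real.sqrt_sq (by positivity)]
  have hn1 : ∀ᶠ n : ℕ in atTop, |(k n : ℝ) / n - q| ≤ q / 2 :=
    habs.eventually_le_const (by linarith)
  have hn2 : ∀ᶠ n : ℕ in atTop, |(k n : ℝ) / n - q| ≤ (1 - q) / 2 :=
    habs.eventually_le_const (by linarith)
  have hlo : ∀ᶠ n : ℕ in atTop, q / 2 ≤ (k n : ℝ) / n := by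
    filter_upwards [hn1] with n h
    have := (abs_le.1 h).1; linarith
  have hhi : ∀ᶠ n : ℕ in atTop, (1 - q) / 2 ≤ 1 - (k n : ℝ) / n := by
    filter_upwards [hn2] with n h
    have := (abs_le.1 h).2; linarith
  have hkk : ∀ᶠ n : ℕ in atTop, 0 < k n ∧ k n < n := by
    filter_upwards [hlo, hhi, eventually_ge_atTop 1] with n h1 h2 hn
    have hnr : (0 : ℝ) < n := by exact_mod_cast hn
    constructor
    · rcases Nat.eq_zero_or_pos (k n) with h | h
      · rw [h] at h1; simp at h1; linarith
      · exact h
    · have : (k n : ℝ) / n < 1 := by linarith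
      rw [div_lt_one hnr] at this
      exact_mod_cast this
  have T1 : Tendsto (fun n : ℕ => (m n : ℝ) * (Real.log q - Real.log ((k n : ℝ) / n)))
      atTop (𝓝 0) := by
    refine squeeze_zero_norm' ?_ (by simpa using hmabs.const_mul (2 / q))
    filter_upwards [hlo] with n h
    rw [Real.norm_eq_abs, abs_mul, Nat.abs_cast]
    have := mul_le_mul_of_nonneg_left (abs_log_diff_le hq h) (Nat.cast_nonneg (α := ℝ) (m n))
    linarith
  have T2 : Tendsto (fun n : ℕ => (m n : ℝ) * (Real.log (1 - q) - Real.log (1 - (k n : ℝ) / n)))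
      atTop (𝓝 0) := by
    refine squeeze_zero_norm' ?_ (by simpa using hmabs.const_mul (2 / (1 - q)))
    filter_upwards [hhi] with n h
    rw [Real.norm_eq_abs, abs_mul, Nat.abs_cast]
    have := mul_le_mul_of_nonneg_left (abs_log_diff_le hq' h) (Nat.cast_nonneg (α := ℝ) (m n))
    have e0 : 1 - (k n : ℝ) / n - (1 - q) = -((k n : ℝ) / n - q) := by ring
    rw [e0, abs_neg] at this
    linarith
  obtain ⟨C, hC⟩ := kl_taylor hq hq1
  have T3 : Tendsto (fun n : ℕ => (m n : ℝ) * (n * kl q ((k n : ℝ) / n)))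
      atTop (𝓝 (Y / (2 * (q * (1 - q))))) := by
    have h0 : Tendsto (fun n : ℕ => (m n : ℝ) * (n * kl q ((k n : ℝ) / n))
        - (m n : ℝ) * n * ((k n : ℝ) / n - q) ^ 2 / (2 * (q * (1 - q)))) atTop (𝓝 0) := by
      have hb := (hY.mul habs).const_mul C
      rw [mul_zero, mul_zero] at hb
      refine squeeze_zero_norm' ?_ hb
      filter_upwards [hn1, hn2] with n a1 a2
      have := hC _ a1 a2
      have e : (m n : ℝ) * (n * kl q ((k n : ℝ) / n))
        - (m n : ℝ) * n * ((k n : ℝ) / n - q) ^ 2 / (2 * (q * (1 - q)))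
        = (m n * n) * (kl q ((k n : ℝ) / n) - ((k n : ℝ) / n - q) ^ 2 / (2 * (q * (1 - q)))) := by
        ring
      rw [Real.norm_eq_abs, e, abs_mul, abs_of_nonneg (by positivity : (0 : ℝ) ≤ m n * n)]
      refine (mul_le_mul_of_nonneg_left this (by positivity)).trans (le_of_eq ?_)
      rw [← sq_abs ((k n : ℝ) / n - q)]
      ring
    have := h0.add (hY.div_const (2 * (q * (1 - q))))
    rw [zero_add] at this
    refine this.congr fun n => ?_
    ring
  have T4 : Tendsto (fun n : ℕ => (m n : ℝ) * th n) atTop (𝓝 0) := by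
    refine squeeze_zero' ?_ ?_ hm
    · filter_upwards [eventually_ge_atTop 1] with n hn
      exact mul_nonneg (Nat.cast_nonneg _) (th_nonneg (by omega))
    · filter_upwards [eventually_ge_atTop 1] with n hn
      have hnr : (0 : ℝ) < n := by exact_mod_cast hn
      rw [div_eq_mul_one_div]
      gcongr
      refine (th_le (by omega)).trans ?_
      apply one_div_le_one_div_of_le hnr; linarith
  have aux : ∀ (j : ℕ → ℕ) (r : ℝ), 0 < r → (∀ᶠ n : ℕ in atTop, 0 < j n ∧ r * n ≤ j n) →
      Tendsto (fun n : ℕ => (m n : ℝ) * th (j n)) atTop (𝓝 0) := by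
    intro j r hr hj
    refine squeeze_zero' (g := fun n : ℕ => (1 / r) * ((m n : ℝ) / n)) ?_ ?_
      (by simpa using hm.const_mul (1 / r))
    · filter_upwards [hj] with n hn
      exact mul_nonneg (Nat.cast_nonneg _) (th_nonneg (by omega))
    · filter_upwards [hj, eventually_ge_atTop 1] with n hj hn
      have hnr : (0 : ℝ) < n := by exact_mod_cast hn
      have e : (1 / r) * ((m n : ℝ) / n) = m n * (1 / (r * n)) := by field_simp
      rw [e]
      gcongr
      refine (th_le (by omega)).trans ?_
      apply one_div_le_one_div_of_le (by positivity)
      have : (0 : ℝ) ≤ j n := by positivity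
      linarith [hj.2]
  have T5 : Tendsto (fun n : ℕ => (m n : ℝ) * th (k n)) atTop (𝓝 0) := by
    refine aux k (q / 2) (by linarith) ?_
    filter_upwards [hkk, hlo, eventually_ge_atTop 1] with n h1 h2 hn
    have hnr : (0 : ℝ) < n := by exact_mod_cast hn
    exact ⟨h1.1, (le_div_iff₀ hnr).1 h2⟩
  have T6 : Tendsto (fun n : ℕ => (m n : ℝ) * th (n - k n)) atTop (𝓝 0) := by
    refine aux (fun n => n - k n) ((1 - q) / 2) (by linarith) ?_
    filter_upwards [hkk, hhi, eventually_ge_atTop 1] with n h1 h2 hn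
    have hnr : (0 : ℝ) < n := by exact_mod_cast hn
    refine ⟨by omega, ?_⟩
    rw [Nat.cast_sub h1.2.le]
    have e : (n : ℝ) - k n = (1 - (k n : ℝ) / n) * n := by field_simp
    rw [e]
    gcongr
  have T := ((((((T1.div_const 2).add (T2.div_const 2)).sub T3).add T4).sub T5).sub T6)
  have T' := (Real.continuous_exp.tendsto _).comp T
  simp only [zero_div, zero_add, add_zero, sub_zero, zero_sub] at T'
  refine T'.congr' ?_
  filter_upwards [hkk] with n h
  rw [ff_formula hq hq1 h.1 h.2, ← Real.exp_nat_mul]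
  simp only [Function.comp]
  congr 1
  ring

lemma step_eq (a : ℕ → ℝ) (n : ℕ) (ha : ∀ k, n < k → a k = 0) (c h : ℝ) (hh : 0 < h) :
    (fun y : ℝ => if 0 ≤ c + y / h then a ⌊c + y / h⌋₊ else 0)
      = fun y => ∑ k ∈ Finset.range (n + 1),
        (Set.Ico (((k : ℝ) - c) * h) (((k : ℝ) + 1 - c) * h)).indicator (fun _ => a k) y := by
  funext y
  have hmem : ∀ k : ℕ, y ∈ Set.Ico (((k : ℝ) - c) * h) (((k : ℝ) + 1 - c) * h) ↔
      (k : ℝ) ≤ c + y / h ∧ c + y / h < k + 1 := by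
    intro k
    rw [Set.mem_Ico, ← le_div_iff₀ hh, ← div_lt_iff₀ hh]
    constructor
    · rintro ⟨h1, h2⟩; constructor <;> linarith
    · rintro ⟨h1, h2⟩; constructor <;> linarith
  set x := c + y / h with hx
  split_ifs with h0
  · have hmem2 : ∀ k : ℕ, y ∈ Set.Ico (((k : ℝ) - c) * h) (((k : ℝ) + 1 - c) * h) ↔
        ⌊x⌋₊ = k := by
      intro k; rw [hmem, Nat.floor_eq_iff h0]
    simp only [Set.indicator_apply, hmem2]
    rw [Finset.sum_ite_eq]
    split_ifs with h1
    · rfl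
    · apply ha
      simp at h1; omega
  · symm
    apply Finset.sum_eq_zero
    intro k _
    apply Set.indicator_of_notMem
    rw [hmem]
    rintro ⟨h1, _⟩
    exact h0 ((Nat.cast_nonneg k).trans h1)

lemma step_meas (a : ℕ → ℝ) (n : ℕ) (ha : ∀ k, n < k → a k = 0) (c h : ℝ) (hh : 0 < h) :
    Measurable (fun y : ℝ => if 0 ≤ c + y / h then a ⌊c + y / h⌋₊ else 0) := by
  rw [step_eq a n ha c h hh]
  refine Finset.measurable_sum _ fun k _ => ?_
  exact measurable_const.indicator measurableSet_Ico

lemma step_integral (a : ℕ → ℝ) (n : ℕ) (ha : ∀ k, n < k → a k = 0) (c h : ℝ) (hh : 0 < h) :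
    ∫ y : ℝ, (if 0 ≤ c + y / h then a ⌊c + y / h⌋₊ else 0)
      = (∑ k ∈ Finset.range (n + 1), a k) * h := by
  rw [step_eq a n ha c h hh, MeasureTheory.integral_finsetSum]
  · rw [Finset.sum_mul]
    refine Finset.sum_congr rfl fun k _ => ?_
    rw [MeasureTheory.integral_indicator_const _ measurableSet_Ico, Real.volume_real_Ico_of_le
      (by nlinarith)]
    simp only [smul_eq_mul]
    ring
  · intro k _
    rw [MeasureTheory.integrable_indicator_iff measurableSet_Ico]
    exact MeasureTheory.integrableOn_const (by simp)

open Filter Topology in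
lemma main_int {q : ℝ} (hq0 : 0 < q) (hq1 : q < 1) (m : ℕ → ℕ) (hm1 : ∀ n, 1 ≤ m n)
    (hm : Tendsto (fun n : ℕ => (m n : ℝ) / n) atTop (𝓝 0)) :
    Tendsto (fun n : ℕ => (∑ k ∈ Finset.range (n + 1), ff q n k ^ m n)
      * Real.sqrt (m n / (n * (q * (1 - q))))) atTop (𝓝 (Real.sqrt (2 * Real.pi))) := by
  have hq' : 0 < 1 - q := by linarith
  set v := q * (1 - q) with hv
  have hvp : 0 < v := by positivity
  set h : ℕ → ℝ := fun n => Real.sqrt (m n / (n * v)) with hh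
  have hmp : ∀ n, (0 : ℝ) < m n := fun n => by exact_mod_cast hm1 n
  have hhp : ∀ n : ℕ, 1 ≤ n → 0 < h n := by
    intro n hn
    have hnr : (0 : ℝ) < n := by exact_mod_cast hn
    have := hmp n
    exact Real.sqrt_pos.2 (by positivity)
  have hhsq : ∀ n, h n ^ 2 = m n / (n * v) := fun n => Real.sq_sqrt (by positivity)
  have hh0 : Tendsto h atTop (𝓝 0) := by
    have := (hm.div_const v).sqrt
    rw [zero_div, Real.sqrt_zero] at this
    refine this.congr fun n => ?_
    simp only [hh]
    rw [div_div]
  let F : ℕ → ℝ → ℝ := fun n y =>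
    if 0 ≤ n * q + y / h n then ff q n ⌊n * q + y / h n⌋₊ ^ m n else 0
  have hff0 : ∀ n k, n < k → ff q n k ^ m n = 0 := by
    intro n k hk
    unfold ff phi
    rw [Nat.choose_eq_zero_of_lt hk]
    have := hm1 n
    simp; omega
  have hffn : ∀ n k, 0 ≤ ff q n k := fun n k =>
    mul_nonneg (phi_nonneg hq0.le hq1.le _ _) (Real.sqrt_nonneg _)
  obtain ⟨C, hC0, hC⟩ := ff_bound hq0 hq1
  have key : Tendsto (fun n => ∫ y, F n y) atTop (𝓝 (∫ y : ℝ, Real.exp (-(1 / 2) * y ^ 2))) := by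
    refine MeasureTheory.tendsto_integral_filter_of_dominated_convergence
      (fun y => Real.exp (1 / 8 + C) * Real.exp (-(v / 16) * y ^ 2)) ?_ ?_ ?_ ?_
    · filter_upwards [eventually_ge_atTop 1] with n hn
      exact (step_meas (fun k => ff q n k ^ m n) n (hff0 n) _ _ (hhp n hn)).aestronglyMeasurable
    · filter_upwards [eventually_ge_atTop 1, hC, hm.eventually_le_const one_pos] with n hn hCn hmn
      refine Eventually.of_forall fun y => ?_
      simp only [F]
      have hnr : (0 : ℝ) < n := by exact_mod_cast hn
      split_ifs with hx
      swap
      · rw [norm_zero]; positivity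
      rw [Real.norm_eq_abs, abs_of_nonneg (pow_nonneg (hffn _ _) _)]
      set x := n * q + y / h n with hxd
      have hb := pow_le_pow_left₀ (hffn _ _) (hCn ⌊x⌋₊) (m n)
      refine hb.trans ?_
      rw [← Real.exp_nat_mul, ← Real.exp_add]
      apply Real.exp_le_exp.2
      have hfl := Nat.floor_le hx
      have hfu := Nat.lt_floor_add_one x
      set k : ℝ := (⌊x⌋₊ : ℝ)
      have hy : y = h n * (x - n * q) := by
        rw [hxd]; have := (hhp n hn).ne'; field_simp; ring
      have hy2 : y ^ 2 ≤ h n ^ 2 * (2 * (k - n * q) ^ 2 + 2) := by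
        rw [hy, mul_pow]
        apply mul_le_mul_of_nonneg_left _ (sq_nonneg _)
        have : (x - k) ^ 2 ≤ 1 := by nlinarith
        nlinarith [sq_nonneg ((k - n * q) - (x - k))]
      rw [hhsq] at hy2
      have e1 : (m n : ℝ) * (-(n * (k / n - q) ^ 2 / 8) + C / n)
        = -(v / 16) * (m n / (n * v) * (2 * (k - n * q) ^ 2 + 2)) + (1 / 8 + C) * (m n / n) := by
        field_simp; ring
      rw [e1]
      have := mul_le_mul_of_nonneg_left hy2 (by positivity : 0 ≤ v / 16)
      have := mul_le_mul_of_nonneg_left hmn (by positivity : 0 ≤ 1 / 8 + C)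
      linarith
    · exact (integrable_exp_neg_mul_sq (by positivity)).const_mul _
    · refine Eventually.of_forall fun y => ?_
      have hxn : ∀ᶠ n : ℕ in atTop, 0 ≤ n * q + y / h n := by
        have h1 : Tendsto (fun n : ℕ => (n : ℝ) * h n * q) atTop atTop := by
          have : Tendsto (fun n : ℕ => Real.sqrt (n * (1 / v)) * q) atTop atTop := by
            refine Tendsto.atTop_mul_const hq0 ?_
            refine Real.tendsto_sqrt_atTop.comp ?_
            exact (tendsto_natCast_atTop_atTop).atTop_mul_const (by positivity)
          refine tendsto_atTop_mono' _ ?_ this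
          filter_upwards [eventually_ge_atTop 1] with n hn
          have hnr : (0 : ℝ) < n := by exact_mod_cast hn
          have : (1 : ℝ) ≤ m n := by exact_mod_cast hm1 n
          gcongr
          apply Real.sqrt_le_iff.2
          refine ⟨mul_nonneg hnr.le (hhp n hn).le, ?_⟩
          rw [mul_pow, hhsq]
          have e : (n : ℝ) ^ 2 * (m n / (n * v)) = n * (m n / v) := by field_simp
          rw [e]
          gcongr
        filter_upwards [eventually_ge_atTop 1, tendsto_atTop.1 h1 (-y)] with n hn h2
        have h3 := hhp n hn
        have e : n * q + y / h n = (n * h n * q + y) / h n := by field_simp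
        rw [e]
        apply div_nonneg _ h3.le
        linarith
      have hlim : Tendsto (fun n : ℕ => h n * ((⌊n * q + y / h n⌋₊ : ℝ) - n * q)) atTop (𝓝 y) := by
        have h0 : Tendsto (fun n : ℕ => h n * ((⌊n * q + y / h n⌋₊ : ℝ) - n * q) - y)
            atTop (𝓝 0) := by
          refine squeeze_zero_norm' ?_ hh0
          filter_upwards [eventually_ge_atTop 1, hxn] with n hn hx
          have h3 := hhp n hn
          have hfl := Nat.floor_le hx
          have hfu := Nat.lt_floor_add_one (n * q + y / h n)
          set x := n * q + y / h n with hxd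
          have hy : y = h n * (x - n * q) := by
            rw [hxd]; field_simp; ring
          have e : h n * ((⌊x⌋₊ : ℝ) - n * q) - y = h n * ((⌊x⌋₊ : ℝ) - x) := by
            linear_combination -hy
          rw [e, Real.norm_eq_abs, abs_mul, abs_of_pos h3]
          apply mul_le_of_le_one_right h3.le
          rw [abs_le]; constructor <;> linarith
        simpa using h0.add_const y
      have hY : Tendsto (fun n : ℕ => (m n : ℝ) * n
          * ((⌊n * q + y / h n⌋₊ : ℝ) / n - q) ^ 2) atTop (𝓝 (v * y ^ 2)) := by
        refine ((hlim.pow 2).const_mul v).congr' ?_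
        filter_upwards [eventually_ge_atTop 1] with n hn
        have hnr : (0 : ℝ) < n := by exact_mod_cast hn
        rw [mul_pow, hhsq]
        field_simp
      have hP := ff_pointwise hq0 hq1 m (fun n => ⌊n * q + y / h n⌋₊) hm1 hm _ hY
      have e : -(v * y ^ 2 / (2 * (q * (1 - q)))) = -(1 / 2) * y ^ 2 := by
        rw [← hv]; field_simp
      rw [e] at hP
      refine hP.congr' ?_
      filter_upwards [hxn] with n hx
      simp only [F]
      rw [if_pos hx]
  rw [integral_gaussian] at key
  have e : Real.pi / (1 / 2) = 2 * Real.pi := by ring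
  rw [e] at key
  refine key.congr' ?_
  filter_upwards [eventually_ge_atTop 1] with n hn
  exact step_integral (fun k => ff q n k ^ m n) n (hff0 n) _ _ (hhp n hn)

/-- Proposition 4.3 (asymptotic): if m(n) ≥ 1 and m(n) = o(√n), then
∑_{k=0}^n φ_q(k,n)^{m(n)} ∼ (2πq(1−q)n)^{−(m(n)−1)/2} / √(m(n)) as n → ∞. -/
theorem sum_phi_pow_asymptotic (q : ℝ) (hq0 : 0 < q) (hq1 : q < 1) (m : ℕ → ℕ)
    (hm1 : ∀ n, 1 ≤ m n)
    (hm : Filter.Tendsto (fun n : ℕ => (m n : ℝ) / Real.sqrt n) Filter.atTop (nhds 0)) :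
    Filter.Tendsto
      (fun n : ℕ =>
        (∑ k ∈ Finset.range (n + 1), phi q k n ^ m n) *
          (2 * Real.pi * q * (1 - q) * n) ^ (((m n : ℝ) - 1) / 2) *
          Real.sqrt (m n))
      Filter.atTop (nhds 1) := by
  have hq' : 0 < 1 - q := by linarith
  have hm' : Filter.Tendsto (fun n : ℕ => (m n : ℝ) / n) Filter.atTop (nhds 0) := by
    refine squeeze_zero' (Filter.Eventually.of_forall fun n => by positivity) ?_ hm
    filter_upwards [Filter.eventually_ge_atTop 1] with n hn
    have hnr : (1 : ℝ) ≤ n := by exact_mod_cast hn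
    have : 0 < Real.sqrt n := Real.sqrt_pos.2 (by linarith)
    apply div_le_div_of_nonneg_left (by positivity) this
    rw [Real.sqrt_le_left (by linarith)]
    nlinarith
  have h := (main_int hq0 hq1 m hm1 hm').div_const (Real.sqrt (2 * Real.pi))
  rw [div_self (by positivity)] at h
  refine h.congr' ?_
  filter_upwards [Filter.eventually_ge_atTop 1] with n hn
  have hnr : (0 : ℝ) < n := by exact_mod_cast hn
  have hA : 0 < 2 * Real.pi * q * (1 - q) * n := by positivity
  have e1 : (2 * Real.pi * q * (1 - q) * n) ^ (((m n : ℝ) - 1) / 2)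
      = Real.sqrt (2 * Real.pi * q * (1 - q) * n) ^ m n
        / Real.sqrt (2 * Real.pi * q * (1 - q) * n) := by
    have e : ((m n : ℝ) - 1) / 2 = (1 / 2) * m n - 1 / 2 := by ring
    rw [e, Real.rpow_sub hA, Real.rpow_mul hA.le, Real.rpow_natCast, ← Real.sqrt_eq_rpow]
  have e2 : ∑ k ∈ Finset.range (n + 1), ff q n k ^ m n
      = (∑ k ∈ Finset.range (n + 1), phi q k n ^ m n)
        * Real.sqrt (2 * Real.pi * q * (1 - q) * n) ^ m n := by
    rw [Finset.sum_mul]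
    refine Finset.sum_congr rfl fun k _ => ?_
    rw [ff, mul_pow]
  have e3 : Real.sqrt (2 * Real.pi * q * (1 - q) * n)
      = Real.sqrt (2 * Real.pi) * Real.sqrt (n * (q * (1 - q))) := by
    rw [← Real.sqrt_mul (by positivity)]
    congr 1; ring
  rw [e1, e2, Real.sqrt_div (by positivity), e3]
  have s1 : 0 < Real.sqrt (2 * Real.pi) := by positivity
  have s2 : 0 < Real.sqrt (n * (q * (1 - q))) := by positivity
  field_simp
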